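/- Fix q₀ ∈ (0,1) and for t ∈ (0,1] set q(t) = q₀^t. Let μ ∈ ℂ and let λ : (0,1] → ℂ* satisfy (λ(t) − 1)/(q(t) − 1) → μ as t → 0⁺. Then lim_{t→0⁺} e_{q(t),λ(t)}(Q) = Q^μ := exp(μ · Log Q) uniformly on compact subsets of ℂ∖(−∞,0], where Log denotes the principal branch of the logarithm. -/

import Mathlib

open Filter

/-- Jacobi's theta function `θ_q(Q) = Σ_{d∈ℤ} q^{d(d−1)/2} Q^d`. -/
noncomputable def thetaFn (q Q : ℂ) : ℂ := ∑' d : ℤ, q ^ (d * (d - 1) / 2) * Q ^ d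

/-- The q-character `e_{q,λ}(Q) = θ_q(Q)/θ_q(λQ)`. -/
noncomputable def qChar (q lam Q : ℂ) : ℂ := thetaFn q Q / thetaFn q (lam * Q)

/-- The closed negative real axis `(−∞,0] ⊆ ℂ`. -/
def negRay : Set ℂ := {z : ℂ | z.im = 0 ∧ z.re ≤ 0}

open Topology

open Complex in
/-- `ϑ(z, τ) → 1` when `Im τ` dominates `2 |Im z|`. -/
theorem tendsto_jacobiTheta₂_one {α : Type*} {F : Filter α} {z τ : α → ℂ}
    (h : Tendsto (fun a => (τ a).im - 2 * |(z a).im|) F atTop) :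
    Tendsto (fun a => jacobiTheta₂ (z a) (τ a)) F (𝓝 1) := by
  have key : ∀ (n : ℤ) (a : α), 0 ≤ (τ a).im - 2 * |(z a).im| →
      ‖jacobiTheta₂_term n (z a) (τ a)‖
        ≤ Real.exp (-(Real.pi * |(n : ℝ)|) * ((τ a).im - 2 * |(z a).im|)) := by
    intro n a ha
    rw [norm_jacobiTheta₂_term]
    apply Real.exp_le_exp.mpr
    have hn : |(n : ℝ)| ≤ (n : ℝ) ^ 2 := by
      rw [← sq_abs]
      have h1 : |n| ≤ |n| ^ 2 := Int.le_self_sq _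
      exact_mod_cast h1
    have h2 : -((n : ℝ) * (z a).im) ≤ |(n : ℝ)| * |(z a).im| := by
      rw [← abs_mul]; exact neg_le_abs _
    have h3 : |(n : ℝ)| * (τ a).im ≤ (n : ℝ) ^ 2 * (τ a).im := by
      have : 0 ≤ (τ a).im := by linarith [abs_nonneg (z a).im]
      gcongr
    nlinarith [Real.pi_pos]
  have hsum : Summable (fun n : ℤ => Real.exp (-(Real.pi * |(n : ℝ)|))) := by
    have hs : Summable (fun n : ℕ => Real.exp (-Real.pi) ^ n) :=
      summable_geometric_of_lt_one (Real.exp_pos _).le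
        (Real.exp_lt_one_iff.mpr (by linarith [Real.pi_pos]))
    apply Summable.of_nat_of_neg <;>
    · refine hs.congr fun n => ?_
      rw [← Real.exp_nat_mul]
      congr 1
      simp
      ring
  have hlim : ∀ n : ℤ, Tendsto (fun a => jacobiTheta₂_term n (z a) (τ a)) F
      (𝓝 (if n = 0 then 1 else 0)) := by
    intro n
    rcases eq_or_ne n 0 with rfl | hn
    · simp [jacobiTheta₂_term, tendsto_const_nhds]
    · rw [if_neg hn]
      apply squeeze_zero_norm' ((h.eventually_ge_atTop 0).mono fun a ha => key n a ha)
      refine Real.tendsto_exp_atBot.comp (h.const_mul_atTop_of_neg ?_)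
      have : 0 < |(n : ℝ)| := by positivity
      nlinarith [Real.pi_pos]
  have := tendsto_tsum_of_dominated_convergence hsum hlim
    ((h.eventually_ge_atTop 1).mono fun a ha n => (key n a (by linarith)).trans
      (Real.exp_le_exp.mpr (by
        have : 0 ≤ Real.pi * |(n : ℝ)| := by positivity
        nlinarith)))
  simpa [jacobiTheta₂] using this

open Complex in
/-- `θ_q` in terms of Mathlib's two-variable theta function. -/
theorem thetaFn_exp (ε w : ℂ) :
    thetaFn (exp (-ε)) (exp w) =
      jacobiTheta₂ ((w + ε / 2) / (2 * Real.pi * I)) (I * ε / (2 * Real.pi)) := by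
  unfold thetaFn jacobiTheta₂
  refine tsum_congr fun d => ?_
  have hπ : (Real.pi : ℂ) ≠ 0 := by exact_mod_cast Real.pi_ne_zero
  have hd : (((d * (d - 1) / 2 : ℤ)) : ℂ) = (d : ℂ) * (d - 1) / 2 := by
    rw [Int.cast_div (Int.even_mul_pred_self d).two_dvd (by norm_num)]
    push_cast
    rfl
  rw [jacobiTheta₂_term, ← exp_int_mul, ← exp_int_mul, ← exp_add, hd]
  congr 1
  have hI : I ^ 2 = -1 := I_sq
  field_simp
  rw [hI]
  ring

open Complex in
/-- Modular transformation of `θ_q`, with `q = exp (-ε)` and `Q = exp w`. -/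
theorem thetaFn_exp_modular {ε : ℂ} (hε : ε ≠ 0) (w : ℂ) :
    thetaFn (exp (-ε)) (exp w) =
      1 / (ε / (2 * Real.pi)) ^ (1 / 2 : ℂ) * exp ((w + ε / 2) ^ 2 / (2 * ε)) *
        jacobiTheta₂ (-(w + ε / 2) / ε) (2 * Real.pi * I / ε) := by
  have hπ : (Real.pi : ℂ) ≠ 0 := by exact_mod_cast Real.pi_ne_zero
  have hI : I ^ 2 = -1 := I_sq
  have h1 : -I * (I * ε / (2 * Real.pi)) = ε / (2 * Real.pi) := by
    linear_combination (-ε / (2 * Real.pi)) * hI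
  have h2 : -Real.pi * I * ((w + ε / 2) / (2 * Real.pi * I)) ^ 2 / (I * ε / (2 * Real.pi)) =
      (w + ε / 2) ^ 2 / (2 * ε) := by
    field_simp
    linear_combination -(w * 2 + ε) ^ 2 * hI
  have h3 : (w + ε / 2) / (2 * Real.pi * I) / (I * ε / (2 * Real.pi)) = -(w + ε / 2) / ε := by
    field_simp
    linear_combination (w * 2 + ε) * hI
  have h4 : -1 / (I * ε / (2 * Real.pi)) = 2 * Real.pi * I / ε := by
    field_simp
    linear_combination -hI
  rw [thetaFn_exp, jacobiTheta₂_functional_equation, h1, h2, h3, h4]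

open Complex in
/-- The q-character after the modular transformation. -/
theorem qChar_exp {ε : ℂ} (hε : ε ≠ 0) (l w : ℂ) :
    qChar (exp (-ε)) (exp l) (exp w) =
      exp (-(l / ε) * (w + (l + ε) / 2)) *
        (jacobiTheta₂ (-(w + ε / 2) / ε) (2 * Real.pi * I / ε) /
          jacobiTheta₂ (-(l + w + ε / 2) / ε) (2 * Real.pi * I / ε)) := by
  have hπ : (Real.pi : ℂ) ≠ 0 := by exact_mod_cast Real.pi_ne_zero
  have hC : 1 / (ε / (2 * Real.pi)) ^ (1 / 2 : ℂ) ≠ 0 := by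
    simp [cpow_eq_zero_iff, hε, hπ]
  have hexp : exp ((w + ε / 2) ^ 2 / (2 * ε)) =
      exp (-(l / ε) * (w + (l + ε) / 2)) * exp ((l + w + ε / 2) ^ 2 / (2 * ε)) := by
    rw [← exp_add]
    congr 1
    field_simp
    ring
  have cancel : ∀ C a b x y : ℂ, C ≠ 0 → b ≠ 0 → C * (a * b) * x / (C * b * y) = a * (x / y) := by
    intro C a b x y hC hb
    rw [show C * (a * b) * x = C * b * (a * x) by ring, mul_div_mul_left _ _ (mul_ne_zero hC hb),
      mul_div_assoc]
  rw [qChar, ← exp_add, thetaFn_exp_modular hε, thetaFn_exp_modular hε, hexp,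
    cancel _ _ _ _ _ hC (exp_ne_zero _)]

open Complex in
theorem tendsto_jacobiTheta₂_modular {α : Type*} {F : Filter α} {ε : α → ℝ} {w : α → ℂ}
    {δ : ℝ} (hδ : 0 < δ) (hε : Tendsto ε F (𝓝[>] 0))
    (hw : ∀ᶠ a in F, |(w a).im| ≤ Real.pi - δ) :
    Tendsto (fun a => jacobiTheta₂ (-(w a + ε a / 2) / ε a) (2 * Real.pi * I / ε a)) F (𝓝 1) := by
  apply tendsto_jacobiTheta₂_one
  have hinv : Tendsto (fun a => 2 * δ * (ε a)⁻¹) F atTop :=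
    (tendsto_inv_nhdsGT_zero.comp hε).const_mul_atTop (by positivity)
  refine tendsto_atTop_mono' F ?_ hinv
  filter_upwards [hw, hε.eventually self_mem_nhdsWithin] with a ha hpos
  have hpos : 0 < ε a := hpos
  have h1 : (-(w a + ε a / 2) / (ε a : ℂ)).im = -(w a).im * (ε a)⁻¹ := by
    rw [div_ofReal_im, div_eq_mul_inv]
    have : ((ε a : ℂ) / 2).im = 0 := by
      rw [show (ε a : ℂ) / 2 = ((ε a / 2 : ℝ) : ℂ) by push_cast; rfl, ofReal_im]
    simp [this]
  have h2 : (2 * Real.pi * I / (ε a : ℂ)).im = 2 * Real.pi * (ε a)⁻¹ := by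
    rw [div_ofReal_im, div_eq_mul_inv]
    simp
  rw [h1, h2, abs_mul, abs_neg, abs_of_pos (inv_pos.mpr hpos)]
  have : 0 < (ε a)⁻¹ := inv_pos.mpr hpos
  nlinarith

open Complex in
/-- On a compact subset of the slit plane the argument stays away from `±π`. -/
theorem exists_abs_arg_le_of_isCompact {K : Set ℂ} (hK : IsCompact K) (hsub : K ⊆ slitPlane) :
    ∃ δ > 0, ∀ Q ∈ K, |Q.arg| ≤ Real.pi - δ := by
  rcases K.eq_empty_or_nonempty with rfl | hne
  · exact ⟨1, one_pos, by simp⟩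
  · have hc : ContinuousOn (fun Q : ℂ => |Q.arg|) K := fun Q hQ =>
      (continuousAt_arg (hsub hQ)).abs.continuousWithinAt
    obtain ⟨Q₀, hQ₀, hmax⟩ := hK.exists_isMaxOn hne hc
    refine ⟨Real.pi - |Q₀.arg|, ?_, fun Q hQ => by linarith [isMaxOn_iff.mp hmax Q hQ]⟩
    have : |Q₀.arg| < Real.pi := lt_of_le_of_ne (abs_arg_le_pi _) fun h => by
      rcases (abs_eq Real.pi_pos.le).mp h with h | h
      · exact (mem_slitPlane_iff_arg.mp (hsub hQ₀)).1 h
      · exact (neg_pi_lt_arg Q₀).ne' h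
    linarith

open Complex in
theorem compl_negRay_eq : negRayᶜ = slitPlane := by
  ext z
  simp only [negRay, Set.mem_compl_iff, Set.mem_ofPred_eq, mem_slitPlane_iff, not_and_or, not_le]
  tauto

open Complex in
/-- If `λ → 1` and `(λ - 1) / u → μ`, then `log λ / u → μ`. -/
theorem tendsto_log_div {α : Type*} {F : Filter α} {l u : α → ℂ} {μ : ℂ}
    (hl : Tendsto l F (𝓝 1)) (h : Tendsto (fun a => (l a - 1) / u a) F (𝓝 μ)) :
    Tendsto (fun a => log (l a) / u a) F (𝓝 μ) := by
  have hd : HasDerivAt log 1 1 := by simpa using hasDerivAt_log one_mem_slitPlane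
  have hs : Tendsto (dslope log 1) (𝓝 1) (𝓝 1) := by
    have := (continuousAt_dslope_same.mpr hd.differentiableAt).tendsto
    rwa [dslope_same, hd.deriv] at this
  have := (hs.comp hl).mul h
  rw [one_mul] at this
  refine this.congr fun a => ?_
  have h1 := sub_smul_dslope log 1 (l a)
  rw [log_one, sub_zero, smul_eq_mul] at h1
  rw [← h1, Function.comp_apply]
  ring

theorem tendsto_rpow_sub_one_div {q : ℝ} (hq : 0 < q) :
    Tendsto (fun t : ℝ => (q ^ t - 1) / t) (𝓝[>] 0) (𝓝 (Real.log q)) := by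
  have hd : HasDerivAt (fun t : ℝ => q ^ t) (Real.log q) 0 := by
    simpa using (Real.hasStrictDerivAt_const_rpow hq 0).hasDerivAt
  refine (hd.tendsto_slope.mono_left (nhdsWithin_mono 0 fun t ht => ne_of_gt ht)).congr fun t => ?_
  simp [slope_def_field]

/-- fix `q₀ ∈ (0,1)`, `q(t) = q₀^t`, and let `λ(t) ∈ ℂ*` satisfy
`(λ(t) − 1)/(q(t) − 1) → μ` as `t → 0⁺`.  Then `e_{q(t),λ(t)}(Q) → Q^μ = exp(μ Log Q)`
uniformly on compact subsets of `ℂ∖(−∞,0]`. -/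
theorem stmt_16 (q₀ : ℝ) (hq₀ : q₀ ∈ Set.Ioo (0 : ℝ) 1) (μ : ℂ) (lam : ℝ → ℂ)
    (hlam0 : ∀ t ∈ Set.Ioc (0 : ℝ) 1, lam t ≠ 0)
    (hlim : Tendsto (fun t : ℝ => (lam t - 1) / (((q₀ ^ t : ℝ) : ℂ) - 1))
      (nhdsWithin 0 (Set.Ioi 0)) (nhds μ)) :
    ∀ K : Set ℂ, K ⊆ negRayᶜ → IsCompact K →
      TendstoUniformlyOn
        (fun (t : ℝ) (Q : ℂ) => qChar ((q₀ ^ t : ℝ) : ℂ) (lam t) Q)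
        (fun Q => Complex.exp (μ * Complex.log Q)) (nhdsWithin 0 (Set.Ioi 0)) K := by
  intro K hKsub hK
  rw [compl_negRay_eq] at hKsub
  obtain ⟨hq0, hq1⟩ := hq₀
  set c : ℝ := -Real.log q₀ with hc
  have hcpos : 0 < c := neg_pos.mpr (Real.log_neg hq0 hq1)
  set ε : ℝ → ℝ := fun t => c * t with hεdef
  have hq : ∀ t : ℝ, ((q₀ ^ t : ℝ) : ℂ) = Complex.exp (-(ε t : ℂ)) := fun t => by
    rw [Real.rpow_def_of_pos hq0, hεdef, hc]
    push_cast
    congr 1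
    ring
  have ht : Tendsto (fun t : ℝ => t) (𝓝[>] 0) (𝓝 0) := nhdsWithin_le_nhds
  have hε0 : Tendsto ε (𝓝[>] 0) (𝓝 0) := by simpa using ht.const_mul c
  have hεpos : ∀ᶠ t in 𝓝[>] (0 : ℝ), 0 < ε t :=
    eventually_mem_nhdsWithin.mono fun t h => mul_pos hcpos h
  have hε : Tendsto ε (𝓝[>] 0) (𝓝[>] 0) := tendsto_nhdsWithin_iff.mpr ⟨hε0, hεpos⟩
  have hqε : Tendsto (fun t : ℝ => (((q₀ ^ t : ℝ) : ℂ) - 1) / ε t) (𝓝[>] 0) (𝓝 (-1)) := by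
    have h1 := (tendsto_rpow_sub_one_div hq0).div_const c
    have h2 : Real.log q₀ / c = -1 := by
      rw [show Real.log q₀ = -c by simp [hc], neg_div, div_self hcpos.ne']
    rw [h2] at h1
    have h3 := (Complex.continuous_ofReal.tendsto (-1)).comp h1
    rw [show ((-1 : ℝ) : ℂ) = -1 by simp] at h3
    refine h3.congr fun t => ?_
    simp only [Function.comp_apply, hεdef, div_div, mul_comm t c]
    push_cast
    rfl
  have hq_ne : ∀ᶠ t in 𝓝[>] (0 : ℝ), ((q₀ ^ t : ℝ) : ℂ) - 1 ≠ 0 :=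
    eventually_mem_nhdsWithin.mono fun t h =>
      sub_ne_zero.mpr (by exact_mod_cast (Real.rpow_lt_one hq0.le hq1 h).ne)
  have hlε : Tendsto (fun t : ℝ => (lam t - 1) / ε t) (𝓝[>] 0) (𝓝 (-μ)) := by
    have h1 := hlim.mul hqε
    rw [mul_neg_one] at h1
    refine h1.congr' (hq_ne.mono fun t h => ?_)
    exact div_mul_div_cancel₀ h
  have hεC : Tendsto (fun t => (ε t : ℂ)) (𝓝[>] 0) (𝓝 0) :=
    (Complex.continuous_ofReal.tendsto' 0 0 Complex.ofReal_zero).comp hε0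
  have hlam1 : Tendsto lam (𝓝[>] 0) (𝓝 1) := by
    have h1 := (hlε.mul hεC).add_const 1
    rw [mul_zero, zero_add] at h1
    refine h1.congr' (hεpos.mono fun t h => ?_)
    have : (ε t : ℂ) ≠ 0 := by exact_mod_cast h.ne'
    rw [div_mul_cancel₀ _ this, sub_add_cancel]
  have hlog : Tendsto (fun t => Complex.log (lam t)) (𝓝[>] 0) (𝓝 0) := by
    simpa using hlam1.clog Complex.one_mem_slitPlane
  have ha : Tendsto (fun t => -(Complex.log (lam t) / ε t)) (𝓝[>] 0) (𝓝 μ) := by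
    simpa using (tendsto_log_div hlam1 hlε).neg
  have hb : Tendsto (fun t => (Complex.log (lam t) + ε t) / 2) (𝓝[>] 0) (𝓝 0) := by
    simpa using (hlog.add hεC).div_const 2
  obtain ⟨δ, hδ, harg⟩ := exists_abs_arg_le_of_isCompact hK hKsub
  have hlogc : ContinuousOn Complex.log K := fun Q hQ =>
    (continuousAt_clog (hKsub hQ)).continuousWithinAt
  obtain ⟨M, hM⟩ := hK.exists_bound_of_continuousOn hlogc
  obtain ⟨B, hB⟩ := hK.exists_bound_of_continuousOn
    (f := fun Q => Complex.exp (μ * Complex.log Q)) (by fun_prop)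
  set F : Filter (ℝ × ℂ) := 𝓝[>] (0 : ℝ) ×ˢ 𝓟 K with hF
  have hfst : Tendsto Prod.fst F (𝓝[>] (0 : ℝ)) := tendsto_fst
  have hmem : ∀ᶠ p in F, p.2 ∈ K := tendsto_snd.eventually (mem_principal_self K)
  have hJ1 := tendsto_jacobiTheta₂_modular (w := fun p : ℝ × ℂ => Complex.log p.2) hδ
    (hε.comp hfst) (hmem.mono fun p hp => by simpa [Complex.log_im] using harg _ hp)
  have hJ2 := tendsto_jacobiTheta₂_modular
    (w := fun p : ℝ × ℂ => Complex.log (lam p.1) + Complex.log p.2) (half_pos hδ)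
    (hε.comp hfst) (by
      have h1 : ∀ᶠ p in F, ‖Complex.log (lam p.1)‖ < δ / 2 :=
        (hlog.comp hfst).norm.eventually_lt_const (by simpa using half_pos hδ)
      filter_upwards [hmem, h1] with p hp h2
      have h3 := harg _ hp
      have h4 := Complex.abs_im_le_norm (Complex.log (lam p.1))
      rw [Complex.add_im, Complex.log_im p.2]
      linarith [abs_add_le (Complex.log (lam p.1)).im p.2.arg])
  have hJ := hJ1.div hJ2 one_ne_zero
  rw [div_one] at hJ
  have hbdd : IsBoundedUnder (· ≤ ·) F (norm ∘ fun p : ℝ × ℂ => Complex.log p.2) :=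
    isBoundedUnder_of_eventually_le (hmem.mono fun p hp => hM _ hp)
  have hbdd' : IsBoundedUnder (· ≤ ·) F
      (norm ∘ fun p : ℝ × ℂ => Complex.exp (μ * Complex.log p.2)) :=
    isBoundedUnder_of_eventually_le (hmem.mono fun p hp => hB _ hp)
  have hexponent : Tendsto (fun p : ℝ × ℂ =>
      (-(Complex.log (lam p.1) / ε p.1) - μ) * Complex.log p.2 +
        -(Complex.log (lam p.1) / ε p.1) * ((Complex.log (lam p.1) + ε p.1) / 2)) F (𝓝 0) := by
    have h1 : Tendsto (fun p : ℝ × ℂ => -(Complex.log (lam p.1) / ε p.1) - μ) F (𝓝 0) := by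
      simpa using (ha.comp hfst).sub_const μ
    have h2 := (ha.comp hfst).mul (hb.comp hfst)
    simpa using (h1.zero_mul_isBoundedUnder_le hbdd).add h2
  have hfactor := (((Complex.continuous_exp.tendsto 0).comp hexponent).mul hJ).sub_const 1
  rw [Complex.exp_zero, mul_one, sub_self] at hfactor
  have hdiff := hfactor.zero_mul_isBoundedUnder_le hbdd'
  rw [Metric.tendstoUniformlyOn_iff]
  intro η hη
  have hlam_ne : ∀ᶠ t in 𝓝[>] (0 : ℝ), lam t ≠ 0 := hlam1.eventually_ne one_ne_zero
  have hev := hdiff.norm.eventually_lt_const (by simpa using hη)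
  have hall : ∀ᶠ p in F, dist (Complex.exp (μ * Complex.log p.2))
      (qChar ((q₀ ^ p.1 : ℝ) : ℂ) (lam p.1) p.2) < η := by
    filter_upwards [hev, hmem, hfst.eventually hεpos, hfst.eventually hlam_ne]
      with p hp hpK hpε hpl
    have hεne : (ε p.1 : ℂ) ≠ 0 := by exact_mod_cast hpε.ne'
    have hQ : p.2 ≠ 0 := Complex.slitPlane_ne_zero (hKsub hpK)
    have hform := qChar_exp hεne (Complex.log (lam p.1)) (Complex.log p.2)
    rw [Complex.exp_log hpl, Complex.exp_log hQ] at hform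
    rw [dist_comm, dist_eq_norm, hq, hform]
    refine lt_of_eq_of_lt (congrArg norm ?_) hp
    simp only [Function.comp_apply, Pi.div_apply]
    rw [sub_mul, one_mul, mul_right_comm _ _ (Complex.exp (μ * _)), ← Complex.exp_add]
    congr 3
    ring
  rw [hF, eventually_prod_principal_iff] at hall
  exact hall
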